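/- arXiv:2504.10703 — 2 statements merged into one kernel-verified Lean document; each statement's English description precedes it below -/
import Mathlib

section
/- For every pair of integers x, y with 0 ≤ x < y < u, it holds that |enc(x) ⊕ enc(y)| = max_{x ≤ j < y} |enc(j) ⊕ enc(j+1)|. -/
/-- Length of the longest common prefix of two bit-strings. -/
def lcpLen : List Bool → List Bool → ℕ
  | a :: as, b :: bs => if a = b then lcpLen as bs + 1 else 0
  | _, _ => 0

/-- `|α ⊕ β|`: the length of `β` minus the length of the longest common
prefix of `α` and `β`. -/
def oplusLen (α β : List Bool) : ℕ := β.length - lcpLen α β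

/-- `enc(x)`: the standard binary representation of `x` using exactly `L = log₂ u`
bits (most significant bit first). -/
def encBits (L x : ℕ) : List Bool := (List.range L).map fun i => x.testBit (L - 1 - i)

theorem encBits_succ (L x : ℕ) : encBits (L + 1) x = x.testBit L :: encBits L x := by
  simp only [encBits, List.range_succ_eq_map, List.map_cons, List.map_map]
  congr 1
  apply List.map_congr_left
  intro i _
  simp only [Function.comp_apply]
  congr 1
  omega

theorem length_encBits (L x : ℕ) : (encBits L x).length = L := by
  simp [encBits]

theorem oplusLen_encBits_le_iff_testBit (L x y k : ℕ) :
    oplusLen (encBits L x) (encBits L y) ≤ k ↔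
      ∀ i, k ≤ i → i < L → x.testBit i = y.testBit i := by
  induction L with
  | zero => simp [oplusLen, encBits]
  | succ L ih =>
    by_cases hb : x.testBit L = y.testBit L
    · have hstep : oplusLen (encBits (L + 1) x) (encBits (L + 1) y) =
          oplusLen (encBits L x) (encBits L y) := by
        simp [oplusLen, encBits_succ, lcpLen, hb]
      rw [hstep, ih]
      refine ⟨fun h i hk hi => ?_, fun h i hk hi => h i hk (by omega)⟩
      rcases Nat.lt_succ_iff_lt_or_eq.mp hi with hi | rfl
      · exact h i hk hi
      · exact hb
    · have hstep : oplusLen (encBits (L + 1) x) (encBits (L + 1) y) = L + 1 := by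
        simp [oplusLen, encBits_succ, lcpLen, hb, length_encBits]
      rw [hstep]
      refine ⟨fun h i hk hi => by omega, fun h => ?_⟩
      by_contra hlt
      exact hb (h L (by omega) (by omega))

theorem oplusLen_encBits_le_iff_div {L x y : ℕ} (hx : x < 2 ^ L) (hy : y < 2 ^ L) (k : ℕ) :
    oplusLen (encBits L x) (encBits L y) ≤ k ↔ x / 2 ^ k = y / 2 ^ k := by
  rw [oplusLen_encBits_le_iff_testBit]
  constructor
  · intro h
    apply Nat.eq_of_testBit_eq
    intro i
    rw [Nat.testBit_div_two_pow, Nat.testBit_div_two_pow]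
    by_cases hi : i + k < L
    · exact h _ (by omega) hi
    · have hle : 2 ^ L ≤ 2 ^ (i + k) := Nat.pow_le_pow_right (by norm_num) (by omega)
      rw [Nat.testBit_lt_two_pow (hx.trans_le hle), Nat.testBit_lt_two_pow (hy.trans_le hle)]
  · intro h i hk _
    have hbit := congrArg (fun n => n.testBit (i - k)) h
    simpa only [Nat.testBit_div_two_pow, Nat.sub_add_cancel hk] using hbit

theorem eq_iff_forall_Ico_eq_succ {f : ℕ → ℕ} (hf : Monotone f) {x y : ℕ} (hxy : x ≤ y) :
    f x = f y ↔ ∀ j ∈ Finset.Ico x y, f j = f (j + 1) := by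
  constructor
  · intro h j hj
    rw [Finset.mem_Ico] at hj
    have h₁ := hf hj.1
    have h₂ := hf (Nat.le_succ j)
    have h₃ := hf (Nat.succ_le_of_lt hj.2)
    simp only [Nat.succ_eq_add_one] at h₂ h₃
    omega
  · intro h
    induction y, hxy using Nat.le_induction with
    | base => rfl
    | succ y hy ih =>
      rw [ih fun j hj => h j (by simp only [Finset.mem_Ico] at hj ⊢; omega)]
      exact h y (by simp only [Finset.mem_Ico]; omega)

/-- for `0 ≤ x < y < u = 2^L`,
`|enc(x) ⊕ enc(y)| = max_{x ≤ j < y} |enc(j) ⊕ enc(j+1)|`. -/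
theorem stmt1 (L x y : ℕ) (hxy : x < y) (hy : y < 2 ^ L) :
    oplusLen (encBits L x) (encBits L y) =
      (Finset.Ico x y).sup fun j => oplusLen (encBits L j) (encBits L (j + 1)) := by
  refine eq_of_forall_ge_iff fun k => ?_
  rw [Finset.sup_le_iff, oplusLen_encBits_le_iff_div (hxy.trans hy) hy,
    eq_iff_forall_Ico_eq_succ (f := fun n => n / 2 ^ k)
      (fun _ _ h => Nat.div_le_div_right h) hxy.le]
  refine forall₂_congr fun j hj => ?_
  rw [Finset.mem_Ico] at hj
  rw [oplusLen_encBits_le_iff_div (by omega) (by omega)]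
end

section
/- Let a ∈ U, k ∈ {1,…,log₂ u}, and x, y ∈ [0, 2u) with x < y. Then max_{j ∈ [x+a, y+a)} c^{(k)}_j = 1 if and only if there exists b ∈ [2u − y, 2u − x) such that a ≡ b (mod 2^{k−1}). -/
/-- `c^{(k)}_j`: 1 if `j+1` is a multiple of `2^{k-1}`, and 0 otherwise. -/
def cK (k j : ℕ) : ℕ := if 2 ^ (k - 1) ∣ (j + 1) then 1 else 0

theorem cK_le_one (k j : ℕ) : cK k j ≤ 1 := by
  unfold cK
  split_ifs <;> simp

theorem cK_eq_one_iff (k j : ℕ) : cK k j = 1 ↔ 2 ^ (k - 1) ∣ j + 1 := by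
  simp [cK]

theorem sup_cK_eq_one_iff (k : ℕ) (s : Finset ℕ) :
    (s.sup fun j => cK k j) = 1 ↔ ∃ j ∈ s, 2 ^ (k - 1) ∣ j + 1 := by
  have hle : (s.sup fun j => cK k j) ≤ 1 := Finset.sup_le fun j _ => cK_le_one k j
  rw [← hle.ge_iff_eq, Nat.one_le_iff_ne_zero, ← Nat.pos_iff_ne_zero, Finset.lt_sup_iff]
  refine exists_congr fun j => and_congr_right fun _ => ?_
  rw [← cK_eq_one_iff]
  have := cK_le_one k j
  omega

/-- If `b + c` is a multiple of `m`, then `c` acts as `-b` modulo `m`. -/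
theorem mod_eq_mod_iff_dvd_add {m a b c : ℕ} (h : m ∣ b + c) :
    a % m = b % m ↔ m ∣ a + c := by
  change a ≡ b [MOD m] ↔ _
  rw [← Nat.modEq_zero_iff_dvd] at h ⊢
  exact ⟨fun hab => (hab.add_right c).trans h,
    fun hac => Nat.ModEq.add_right_cancel' c (hac.trans h.symm)⟩

/-- let `u = 2^L`, `a ∈ U = {0,…,u−1}`, `k ∈ {1,…,log₂ u}`, and
`x, y ∈ [0, 2u)` with `x < y`. Then `max_{j ∈ [x+a, y+a)} c^{(k)}_j = 1` if and
only if there exists `b ∈ [2u − y, 2u − x)` with `a ≡ b (mod 2^{k-1})`. -/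
theorem stmt7 (L k : ℕ) (hk1 : 1 ≤ k) (hkL : k ≤ L)
    (a : ℕ) (ha : a < 2 ^ L)
    (x y : ℕ) (hy : y < 2 * 2 ^ L) (hxy : x < y) :
    ((Finset.Ico (x + a) (y + a)).sup fun j => cK k j) = 1 ↔
      ∃ b, 2 * 2 ^ L - y ≤ b ∧ b < 2 * 2 ^ L - x ∧
        a % 2 ^ (k - 1) = b % 2 ^ (k - 1) := by
  have hdvd : 2 ^ (k - 1) ∣ 2 * 2 ^ L :=
    Dvd.dvd.mul_left (pow_dvd_pow 2 (by omega)) 2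
  rw [sup_cK_eq_one_iff]
  constructor
  · rintro ⟨j, hj, hd⟩
    rw [Finset.mem_Ico] at hj
    refine ⟨2 * 2 ^ L - (j - a + 1), by omega, by omega, ?_⟩
    rw [mod_eq_mod_iff_dvd_add (c := j - a + 1)]
    · rwa [show a + (j - a + 1) = j + 1 by omega]
    · rwa [Nat.sub_add_cancel (by omega)]
  · rintro ⟨b, hb1, hb2, hab⟩
    refine ⟨a + (2 * 2 ^ L - b - 1), Finset.mem_Ico.2 ⟨by omega, by omega⟩, ?_⟩
    rw [mod_eq_mod_iff_dvd_add (c := 2 * 2 ^ L - b)] at hab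
    · rwa [show a + (2 * 2 ^ L - b - 1) + 1 = a + (2 * 2 ^ L - b) by omega]
    · rwa [Nat.add_sub_cancel' (by omega)]
end
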